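/- Let $n,p,q,l_1,\ldots,l_n\ge1$ with $p+q=n+\sum_i l_i$. Then $\frac{1}{pq}\left.\frac{\partial^n R_{p,q}}{\partial w_{l_1}\cdots\partial w_{l_n}}\right|_{w_*=0}=-\frac{(n-1)!}{\prod_{i=1}^n l_i}\,\mathrm{Coef}_{z^p\zeta^q}\prod_{i=1}^n\frac{z^{l_i}-\zeta^{l_i}}{z^{-1}-\zeta^{-1}}$, where $R_{p,q}$ is written as a polynomial in the variables $w_*$. -/

import Mathlib

open Finset

noncomputable section

/-- The coefficient ring `ℚ[f₁, f₂, …]` (with `fᵢ = X i`). -/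
abbrev Rf : Type := MvPolynomial ℕ ℚ

/-- We represent formal series `∑_{n ≤ m} aₙ pⁿ` in `p` (finitely many positive powers of `p`,
formal power series in `p⁻¹`) as Laurent series in the variable `q := p⁻¹`:
the coefficient of `pⁿ` is the coefficient of the Laurent series at exponent `-n`. -/
abbrev LS : Type := LaurentSeries Rf

/-- `λ(p) = p + ∑_{i ≥ 1} fᵢ p⁻ⁱ`. -/
def lam : LS :=
  HahnSeries.single (-1 : ℤ) (1 : Rf) +
    HahnSeries.ofPowerSeries ℤ Rf (PowerSeries.mk fun i => if i = 0 then 0 else MvPolynomial.X i)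

/-- `res_{p=0} A`: the coefficient of `p⁻¹` in `A`. -/
def pres (A : LS) : Rf := A.coeff 1

/-- `A₊`: the part of `A` with nonnegative powers of `p`. -/
def plus (A : LS) : LS where
  coeff n := if n ≤ 0 then A.coeff n else 0
  isPWO_support' := A.isPWO_support'.mono (by
    intro n hn
    simp only [Function.mem_support] at hn ⊢
    intro h; apply hn; simp [h])

/-- `∂ₚ A`: the derivative of `A` with respect to `p`. -/
def derivP (A : LS) : LS where
  coeff m := (1 - m) • A.coeff (m - 1)
  isPWO_support' := ((A.isPWO_support'.image_of_monotone
      (f := fun n => n + 1) (fun _ _ h => by dsimp only; omega)).mono (by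
    intro m hm
    simp only [Function.mem_support] at hm
    refine ⟨m - 1, ?_, by ring⟩
    simp only [Function.mem_support]
    intro h; apply hm; rw [h, smul_zero]))

/-- `wᵢ = res_{p=0} λ(p)ⁱ`. -/
def wv (i : ℕ) : Rf := pres (lam ^ i)

/-- `R_{i,j} = -res_{p=0} (λ(p)ʲ₊ ∂ₚ λ(p)ⁱ)`. -/
def Rpq (i j : ℕ) : Rf := - pres (plus (lam ^ j) * derivP (lam ^ i))

end

noncomputable section

/-- The polynomial `(z^l - ζ^l)/(z⁻¹ - ζ⁻¹) = -∑_{k=0}^{l-1} z^(k+1) ζ^(l-k)`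
(with `z = X 0`, `ζ = X 1`), with rational coefficients. -/
def sPolQ (l : ℕ) : MvPolynomial (Fin 2) ℚ :=
  - ∑ k ∈ Finset.range l, MvPolynomial.X 0 ^ (k + 1) * MvPolynomial.X 1 ^ (l - k)

end


section PowerSeriesRecursion

open PowerSeries

variable {A : Type*} [CommRing A]

/-- `L - X L'`; if `λ = p L(p⁻¹)`, this is `∂ₚ λ` as a series in `p⁻¹`. -/
noncomputable def eulerDefect (L : A⟦X⟧) : A⟦X⟧ := L - X * d⁄dX A L

/-- If `λ = p L(p⁻¹)`, this is `p⁻ᵇ (λᵇ)₊` as a series in `p⁻¹`. -/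
noncomputable def truncPow (L : A⟦X⟧) (b : ℕ) : A⟦X⟧ := (trunc (b + 1) (L ^ b) : Polynomial A)

/-- If `λ = p L(p⁻¹)`, this is `wᵢ / i`. -/
noncomputable def normRes [Algebra ℚ A] (L : A⟦X⟧) (i : ℕ) : A := (i : ℚ)⁻¹ • coeff (i + 1) (L ^ i)

/-- If `λ = p L(p⁻¹)`, this is `R_{a+1,b} / (a+1)`. -/
noncomputable def normTwoPoint (L : A⟦X⟧) (a b : ℕ) : A :=
  -coeff (a + 1 + b) (truncPow L b * (L ^ a * eulerDefect L))

lemma coeff_truncPow (L : A⟦X⟧) (b k : ℕ) :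
    coeff k (truncPow L b) = if k < b + 1 then coeff k (L ^ b) else 0 := by
  rw [truncPow, Polynomial.coeff_coe, coeff_trunc]

lemma coeff_pow_mul_eulerDefect (L : A⟦X⟧) (n k : ℕ) :
    ((n : A) + 1) * coeff k (L ^ n * eulerDefect L) =
      ((n : A) + 1 - k) * coeff k (L ^ (n + 1)) := by
  have h : ((n : A⟦X⟧) + 1) * (L ^ n * eulerDefect L) =
      ((n : A⟦X⟧) + 1) * L ^ (n + 1) - X * d⁄dX A (L ^ (n + 1)) := by
    rw [derivative_pow, eulerDefect]
    push_cast
    ring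
  have h2 := congrArg (coeff k) h
  have hC : ((n : A⟦X⟧) + 1) = C ((n : A) + 1) := by simp
  rw [hC, coeff_C_mul, map_sub, coeff_C_mul] at h2
  rw [h2]
  cases k with
  | zero => simp
  | succ k =>
    rw [coeff_succ_X_mul, coeff_derivative]
    push_cast
    ring

lemma pow_mul_inv_pow {L M : A⟦X⟧} (hM : L * M = 1) {i n : ℕ} (h : i ≤ n) :
    L ^ n * M ^ i = L ^ (n - i) := by
  obtain ⟨k, rfl⟩ := Nat.exists_eq_add_of_le h
  rw [pow_add, mul_right_comm, ← mul_pow, hM, one_pow, one_mul, Nat.add_sub_cancel_left]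

lemma pow_mul_inv_pow' {L M : A⟦X⟧} (hM : L * M = 1) (n k : ℕ) :
    L ^ n * M ^ (n + k) = M ^ k := by
  rw [pow_add, ← mul_assoc, ← mul_pow, hM, one_pow, one_mul]

lemma constantCoeff_eulerDefect {L : A⟦X⟧} (h0 : constantCoeff L = 1) :
    constantCoeff (eulerDefect L) = 1 := by
  simp [eulerDefect, h0]

lemma coeff_mul_eq_of_dvd {n : ℕ} {F G : A⟦X⟧} (hF : X ^ n ∣ F) (hG : constantCoeff G = 1) :
    coeff n (F * G) = coeff n F := by
  obtain ⟨K, rfl⟩ := hF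
  rw [mul_assoc, coeff_X_pow_mul', coeff_X_pow_mul']
  simp [hG]

lemma coeff_truncPow_mul {b s : ℕ} (h : s ≤ b) (L F : A⟦X⟧) :
    coeff s (truncPow L b * F) = coeff s (L ^ b * F) := by
  rw [coeff_mul, coeff_mul]
  refine sum_congr rfl fun x hx => ?_
  rw [HasAntidiagonal.mem_antidiagonal] at hx
  rw [coeff_truncPow, if_pos (by omega)]

variable [Algebra ℚ A]

lemma natCast_succ_mul_cancel {n : ℕ} {x y : A} (h : ((n : A) + 1) * x = ((n : A) + 1) * y) :
    x = y := by
  have hn : ((n : ℚ) + 1) ≠ 0 := by positivity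
  have hc : ((n : A) + 1) = algebraMap ℚ A ((n : ℚ) + 1) := by simp
  rw [hc, ← Algebra.smul_def, ← Algebra.smul_def] at h
  have := congrArg (fun t => ((n : ℚ) + 1)⁻¹ • t) h
  simpa [smul_smul, inv_mul_cancel₀ hn] using this

lemma coeff_succ_pow_mul_eulerDefect (L : A⟦X⟧) (n : ℕ) :
    coeff (n + 1) (L ^ n * eulerDefect L) = 0 := by
  apply natCast_succ_mul_cancel (n := n)
  rw [coeff_pow_mul_eulerDefect]
  push_cast
  ring

lemma succ_mul_normRes (L : A⟦X⟧) (n : ℕ) :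
    ((n : A) + 1) * normRes L (n + 1) = coeff (n + 2) (L ^ (n + 1)) := by
  have hn : ((n : ℚ) + 1) ≠ 0 := by positivity
  have hc : ((n : A) + 1) = algebraMap ℚ A ((n : ℚ) + 1) := by simp
  rw [hc, ← Algebra.smul_def, normRes, smul_smul]
  push_cast
  rw [mul_inv_cancel₀ hn, one_smul]

lemma coeff_add_two_pow_mul_eulerDefect (L : A⟦X⟧) (n : ℕ) :
    coeff (n + 2) (L ^ n * eulerDefect L) = -normRes L (n + 1) := by
  apply natCast_succ_mul_cancel (n := n)
  rw [coeff_pow_mul_eulerDefect, mul_neg, succ_mul_normRes]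
  push_cast
  ring

/-- If `λ = p L(p⁻¹)`, this is `p⁻¹ (λ - p - ∑_{i=1}^N (wᵢ/i) λ⁻ⁱ)`, where `M = L⁻¹`. -/
noncomputable def inversionDefect (L M : A⟦X⟧) (N : ℕ) : A⟦X⟧ :=
  L - 1 - ∑ i ∈ range N, C (normRes L (i + 1)) * X ^ (i + 2) * M ^ (i + 1)

lemma X_pow_dvd_inversionDefect {L M : A⟦X⟧} (hM : L * M = 1) (h0 : constantCoeff L = 1)
    (h1 : coeff 1 L = 0) (N : ℕ) : X ^ (N + 2) ∣ inversionDefect L M N := by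
  induction N with
  | zero =>
    rw [X_pow_dvd_iff]
    intro m hm
    interval_cases m
    · simp [inversionDefect, h0]
    · simp [inversionDefect, h1, coeff_one]
  | succ N ih =>
    have hG : constantCoeff (L ^ N * eulerDefect L) = 1 := by
      rw [map_mul, map_pow, h0, constantCoeff_eulerDefect h0]; simp
    have key : coeff (N + 2) (inversionDefect L M N) = normRes L (N + 1) := by
      rw [← coeff_mul_eq_of_dvd ih hG, inversionDefect, sub_mul, sub_mul, sum_mul, one_mul,
        ← mul_assoc, ← pow_succ', map_sub, map_sub, coeff_succ_pow_mul_eulerDefect,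
        coeff_add_two_pow_mul_eulerDefect, map_sum, sum_eq_zero]
      · ring
      intro i hi
      rw [mem_range] at hi
      have : C (normRes L (i + 1)) * X ^ (i + 2) * M ^ (i + 1) * (L ^ N * eulerDefect L) =
          C (normRes L (i + 1)) * (X ^ (i + 2) * (L ^ N * M ^ (i + 1) * eulerDefect L)) := by ring
      rw [this, coeff_C_mul, pow_mul_inv_pow hM (by omega), coeff_X_pow_mul', if_pos (by omega),
        show N + 2 - (i + 2) = N - (i + 1) + 1 by omega, coeff_succ_pow_mul_eulerDefect, mul_zero]
    have hs : inversionDefect L M (N + 1) = inversionDefect L M N -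
        C (normRes L (N + 1)) * X ^ (N + 2) * M ^ (N + 1) := by
      rw [inversionDefect, inversionDefect, sum_range_succ]; ring
    have hM0 : constantCoeff M = 1 := by
      have := congrArg constantCoeff hM
      simpa [h0] using this
    rw [X_pow_dvd_iff]
    intro m hm
    rw [hs, map_sub, mul_assoc, coeff_C_mul, coeff_X_pow_mul']
    rcases Nat.lt_succ_iff_lt_or_eq.mp hm with h | rfl
    · rw [X_pow_dvd_iff.mp ih m h, if_neg (by omega)]; ring
    · rw [key]; simp [hM0]

lemma truncPow_succ {L M : A⟦X⟧} (hM : L * M = 1) (h0 : constantCoeff L = 1)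
    (h1 : coeff 1 L = 0) (b : ℕ) :
    truncPow L (b + 1) = truncPow L b + C (coeff (b + 1) (L ^ b)) * X ^ (b + 1) +
      ∑ i ∈ range b, C (normRes L (i + 1)) * (X ^ (i + 2) * truncPow L (b - 1 - i)) := by
  have hL : L ^ (b + 1) = L ^ b + L ^ b * inversionDefect L M b +
      ∑ i ∈ range b, C (normRes L (i + 1)) * (X ^ (i + 2) * L ^ (b - 1 - i)) := by
    have : ∑ i ∈ range b, C (normRes L (i + 1)) * (X ^ (i + 2) * L ^ (b - 1 - i)) =
        L ^ b * ∑ i ∈ range b, C (normRes L (i + 1)) * X ^ (i + 2) * M ^ (i + 1) := by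
      rw [mul_sum]
      refine sum_congr rfl fun i hi => ?_
      rw [mem_range] at hi
      rw [show b - 1 - i = b - (i + 1) by omega, ← pow_mul_inv_pow hM (by omega)]
      ring
    rw [this, inversionDefect]
    ring
  ext k
  simp only [map_add, map_sum, coeff_C_mul, coeff_X_pow_mul', coeff_truncPow, coeff_X_pow]
  by_cases hk : k < b + 2
  · rw [if_pos hk, hL]
    simp only [map_add, map_sum, coeff_C_mul, coeff_X_pow_mul']
    rw [X_pow_dvd_iff.mp (Dvd.dvd.mul_left (X_pow_dvd_inversionDefect hM h0 h1 b) _) k hk,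
      add_zero]
    congr 1
    · by_cases hk' : k = b + 1
      · subst hk'; simp
      · rw [if_pos (by omega), if_neg hk']; simp
    · refine sum_congr rfl fun i hi => ?_
      rw [mem_range] at hi
      split_ifs <;> first | rfl | omega
  · rw [if_neg hk, if_neg (by omega), if_neg (by omega), sum_eq_zero]
    · simp
    intro i hi
    rw [mem_range] at hi
    split_ifs <;> first | omega | simp

lemma normTwoPoint_zero (L : A⟦X⟧) (a : ℕ) : normTwoPoint L a 0 = 0 := by
  have : truncPow L 0 = 1 := by
    ext k
    rw [coeff_truncPow, coeff_one]
    simp only [pow_zero, coeff_one]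
    split_ifs <;> first | rfl | omega
  rw [normTwoPoint, this, one_mul, add_zero, coeff_succ_pow_mul_eulerDefect, neg_zero]

lemma normTwoPoint_succ {L M : A⟦X⟧} (hM : L * M = 1) (h0 : constantCoeff L = 1)
    (h1 : coeff 1 L = 0) (a b : ℕ) :
    normTwoPoint L a (b + 1) = normTwoPoint L (a + 1) b + normRes L (a + 1 + b)
      - ∑ i ∈ range a, normRes L (i + 1) * normTwoPoint L (a - 1 - i) b
      + ∑ i ∈ range b, normRes L (i + 1) * normTwoPoint L a (b - 1 - i) := by
  have hmain : coeff (a + b + 2) (truncPow L b * (L ^ a * eulerDefect L)) =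
      -normTwoPoint L (a + 1) b - normRes L (a + 1 + b)
      + ∑ i ∈ range a, normRes L (i + 1) * normTwoPoint L (a - 1 - i) b := by
    have hLa : truncPow L b * (L ^ a * eulerDefect L) =
        truncPow L b * (L ^ (a + 1) * eulerDefect L)
        - (∑ i ∈ range (a + (b + 1)), C (normRes L (i + 1)) *
            (X ^ (i + 2) * (truncPow L b * (L ^ a * M ^ (i + 1) * eulerDefect L))))
        - inversionDefect L M (a + (b + 1)) * (truncPow L b * L ^ a * eulerDefect L) := by
      have : (∑ i ∈ range (a + (b + 1)), C (normRes L (i + 1)) *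
            (X ^ (i + 2) * (truncPow L b * (L ^ a * M ^ (i + 1) * eulerDefect L)))) =
          (∑ i ∈ range (a + (b + 1)), C (normRes L (i + 1)) * X ^ (i + 2) * M ^ (i + 1)) *
            (truncPow L b * L ^ a * eulerDefect L) := by
        rw [sum_mul]
        exact sum_congr rfl fun i _ => by ring
      rw [this, inversionDefect]
      ring
    rw [hLa, map_sub, map_sub, X_pow_dvd_iff.mp (Dvd.dvd.mul_right
      (X_pow_dvd_inversionDefect hM h0 h1 (a + (b + 1))) _) (a + b + 2) (by omega), sub_zero,
      map_sum, sum_range_add, sum_range_succ]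
    have e1 : ∀ i ∈ range a, coeff (a + b + 2) (C (normRes L (i + 1)) *
          (X ^ (i + 2) * (truncPow L b * (L ^ a * M ^ (i + 1) * eulerDefect L)))) =
        -(normRes L (i + 1) * normTwoPoint L (a - 1 - i) b) := by
      intro i hi
      rw [mem_range] at hi
      rw [coeff_C_mul, coeff_X_pow_mul', if_pos (by omega), pow_mul_inv_pow hM (by omega),
        normTwoPoint, show a + b + 2 - (i + 2) = a - 1 - i + 1 + b by omega,
        show a - (i + 1) = a - 1 - i by omega]
      ring
    have e2 : ∀ k ∈ range b, coeff (a + b + 2) (C (normRes L (a + k + 1)) *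
          (X ^ (a + k + 2) * (truncPow L b * (L ^ a * M ^ (a + k + 1) * eulerDefect L)))) = 0 := by
      intro k hk
      rw [mem_range] at hk
      rw [coeff_C_mul, coeff_X_pow_mul', if_pos (by omega), coeff_truncPow_mul (by omega),
        add_assoc a k 1, pow_mul_inv_pow' hM, ← mul_assoc, pow_mul_inv_pow hM (by omega),
        show a + b + 2 - (a + k + 2) = b - (k + 1) + 1 by omega, coeff_succ_pow_mul_eulerDefect,
        mul_zero]
    have e3 : coeff (a + b + 2) (C (normRes L (a + b + 1)) *
          (X ^ (a + b + 2) * (truncPow L b * (L ^ a * M ^ (a + b + 1) * eulerDefect L)))) =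
        normRes L (a + b + 1) := by
      have hM0 : constantCoeff M = 1 := by
        have := congrArg constantCoeff hM
        simpa [h0] using this
      rw [coeff_C_mul, coeff_X_pow_mul', if_pos le_rfl, coeff_truncPow_mul (by omega),
        Nat.sub_self]
      simp [h0, hM0, constantCoeff_eulerDefect h0]
    rw [sum_congr rfl e1, sum_congr rfl e2, e3, sum_neg_distrib, sum_const_zero, normTwoPoint,
      show a + 1 + 1 + b = a + b + 2 by omega, show a + 1 + b = a + b + 1 by omega]
    ring
  rw [normTwoPoint, truncPow_succ hM h0 h1, add_mul, add_mul, sum_mul, map_add, map_add, map_sum,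
    show a + 1 + (b + 1) = a + b + 2 by omega, hmain, mul_assoc, coeff_C_mul, coeff_X_pow_mul',
    if_pos (by omega), show a + b + 2 - (b + 1) = a + 1 by omega, coeff_succ_pow_mul_eulerDefect,
    mul_zero]
  have e4 : ∀ i ∈ range b, coeff (a + b + 2) (C (normRes L (i + 1)) *
        (X ^ (i + 2) * truncPow L (b - 1 - i)) * (L ^ a * eulerDefect L)) =
      -(normRes L (i + 1) * normTwoPoint L a (b - 1 - i)) := by
    intro i hi
    rw [mem_range] at hi
    rw [mul_assoc, mul_assoc, coeff_C_mul, coeff_X_pow_mul', if_pos (by omega), normTwoPoint,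
      show a + b + 2 - (i + 2) = a + 1 + (b - 1 - i) by omega]
    ring
  rw [sum_congr rfl e4, sum_neg_distrib]
  ring

end PowerSeriesRecursion

section LaxSeries

open PowerSeries

/-- The series `L` with `λ(p) = p L(p⁻¹)`, where `fᵢ = x i`. -/
noncomputable def laxSeries {A : Type*} [CommRing A] (x : ℕ → A) : A⟦X⟧ :=
  1 + X * PowerSeries.mk fun i => if i = 0 then 0 else x i

section CommRing

variable {A : Type*} [CommRing A]

lemma constantCoeff_laxSeries (x : ℕ → A) : constantCoeff (laxSeries x) = 1 := by
  simp [laxSeries]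

lemma coeff_one_laxSeries (x : ℕ → A) : coeff 1 (laxSeries x) = 0 := by
  rw [laxSeries, map_add, ← zero_add 1, coeff_succ_X_mul]
  simp [coeff_one]

lemma map_laxSeries {B : Type*} [CommRing B] (f : A →+* B) (x : ℕ → A) :
    PowerSeries.map f (laxSeries x) = laxSeries fun i => f (x i) := by
  ext k
  cases k with
  | zero => simp [laxSeries]
  | succ k =>
    rw [PowerSeries.coeff_map, laxSeries, laxSeries, map_add, map_add, map_add, coeff_succ_X_mul,
      coeff_succ_X_mul, coeff_mk, coeff_mk]
    split_ifs <;> simp [coeff_one, *]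

lemma exists_mul_laxSeries_eq_one (x : ℕ → A) : ∃ M, laxSeries x * M = 1 :=
  ⟨invOfUnit (laxSeries x) 1, mul_invOfUnit _ _ (by simp [constantCoeff_laxSeries])⟩

lemma map_normTwoPoint {B : Type*} [CommRing B] (f : A →+* B) (L : A⟦X⟧) (a b : ℕ) :
    f (normTwoPoint L a b) = normTwoPoint (PowerSeries.map f L) a b := by
  have h1 : PowerSeries.map f (truncPow L b) = truncPow (PowerSeries.map f L) b := by
    ext k
    rw [PowerSeries.coeff_map, coeff_truncPow, coeff_truncPow, ← map_pow, PowerSeries.coeff_map]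
    split_ifs <;> simp
  have h2 : PowerSeries.map f (eulerDefect L) = eulerDefect (PowerSeries.map f L) := by
    ext k
    rw [PowerSeries.coeff_map, eulerDefect, eulerDefect, map_sub, map_sub, map_sub, PowerSeries.coeff_map]
    cases k with
    | zero => simp
    | succ k =>
      rw [coeff_succ_X_mul, coeff_succ_X_mul, coeff_derivative, coeff_derivative,
        PowerSeries.coeff_map]
      simp
  rw [normTwoPoint, normTwoPoint, ← h1, ← h2, map_neg, ← map_pow, ← map_mul, ← map_mul,
    PowerSeries.coeff_map]

/-- The residue of `λⁱ` depends on `fᵢ` through the linear term `i fᵢ`, and otherwise only on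
the `fⱼ` with `j < i`. -/
lemma coeff_laxSeries_pow_sub (x y : ℕ → A) (i : ℕ) (h : ∀ j < i, x j = y j) :
    coeff (i + 1) (laxSeries x ^ i) - coeff (i + 1) (laxSeries y ^ i) = i * (x i - y i) := by
  rcases Nat.eq_zero_or_pos i with rfl | hi
  · simp
  have hd : X ^ (i + 1) ∣ laxSeries x - laxSeries y := by
    rw [X_pow_dvd_iff]
    intro m hm
    cases m with
    | zero => simp [laxSeries]
    | succ m =>
      rw [laxSeries, laxSeries, map_sub, map_add, map_add, coeff_succ_X_mul,
        coeff_succ_X_mul, coeff_mk, coeff_mk, h m (by omega)]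
      ring
  obtain ⟨K, hK⟩ := hd
  have hK0 : constantCoeff K = x i - y i := by
    have := congrArg (coeff (i + 1)) hK
    rw [coeff_X_pow_mul', if_pos le_rfl, Nat.sub_self, laxSeries, laxSeries, map_sub, map_add,
      map_add, coeff_succ_X_mul, coeff_succ_X_mul, coeff_mk, coeff_mk, if_neg hi.ne',
      if_neg hi.ne', coeff_zero_eq_constantCoeff_apply] at this
    rw [← this]
    ring
  rw [← map_sub, ← geom_sum₂_mul, hK, mul_left_comm, coeff_X_pow_mul', if_pos le_rfl,
    Nat.sub_self, coeff_zero_eq_constantCoeff_apply, map_mul, hK0, map_sum]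
  simp [constantCoeff_laxSeries]

end CommRing

/-- The series `p^m F(p⁻¹)`. -/
noncomputable def shiftedSeries (m : ℤ) (F : Rf⟦X⟧) : LS :=
  HahnSeries.single (-m) (1 : Rf) * HahnSeries.ofPowerSeries ℤ Rf F

lemma coeff_shiftedSeries (m n : ℤ) (F : Rf⟦X⟧) :
    (shiftedSeries m F).coeff n = if 0 ≤ n + m then coeff (n + m).toNat F else 0 := by
  rw [shiftedSeries, HahnSeries.coeff_single_mul, one_mul, sub_neg_eq_add]
  split_ifs with h
  · obtain ⟨k, hk⟩ := Int.eq_ofNat_of_zero_le h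
    rw [hk, Int.toNat_natCast]
    exact HahnSeries.ofPowerSeries_apply_coeff F k
  · rw [HahnSeries.ofPowerSeries_apply]
    refine HahnSeries.embDomain_of_notMem_range ?_
    rintro ⟨k, hk⟩
    apply h
    rw [← hk]
    exact Int.natCast_nonneg k

lemma shiftedSeries_mul (m n : ℤ) (F G : Rf⟦X⟧) :
    shiftedSeries m F * shiftedSeries n G = shiftedSeries (m + n) (F * G) := by
  rw [shiftedSeries, shiftedSeries, shiftedSeries, mul_mul_mul_comm, HahnSeries.single_mul_single,
    mul_one, map_mul, neg_add]

lemma lam_pow (a : ℕ) : lam ^ a = shiftedSeries a (laxSeries MvPolynomial.X ^ a) := by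
  have h : lam = shiftedSeries 1 (laxSeries MvPolynomial.X) := by
    rw [lam, shiftedSeries, laxSeries, map_add (HahnSeries.ofPowerSeries ℤ Rf),
      map_one (HahnSeries.ofPowerSeries ℤ Rf), map_mul (HahnSeries.ofPowerSeries ℤ Rf),
      HahnSeries.ofPowerSeries_X, mul_add, mul_one, ← mul_assoc, HahnSeries.single_mul_single]
    simp
  induction a with
  | zero => simp [shiftedSeries]
  | succ a ih =>
    rw [pow_succ, ih, h, shiftedSeries_mul, pow_succ]
    push_cast
    rfl

lemma wv_eq (i : ℕ) : wv i = coeff (i + 1) (laxSeries MvPolynomial.X ^ i) := by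
  rw [wv, pres, lam_pow, coeff_shiftedSeries, if_pos (by omega)]
  congr 2
  omega

lemma plus_lam_pow (b : ℕ) :
    plus (lam ^ b) = shiftedSeries b (truncPow (laxSeries MvPolynomial.X) b) := by
  ext1
  funext n
  change (if n ≤ 0 then (lam ^ b).coeff n else 0) = _
  rw [lam_pow, coeff_shiftedSeries, coeff_shiftedSeries, coeff_truncPow]
  split_ifs <;> first | rfl | omega

lemma derivP_lam_pow_succ (a : ℕ) : derivP (lam ^ (a + 1)) =
    shiftedSeries a (((a : Rf⟦X⟧) + 1) *
      (laxSeries MvPolynomial.X ^ a * eulerDefect (laxSeries MvPolynomial.X))) := by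
  ext1
  funext n
  change (1 - n) • (lam ^ (a + 1)).coeff (n - 1) = _
  have hC : ((a : Rf⟦X⟧) + 1) = C ((a : Rf) + 1) := by simp
  rw [lam_pow, coeff_shiftedSeries, coeff_shiftedSeries, hC, coeff_C_mul,
    coeff_pow_mul_eulerDefect]
  have hn : n - 1 + ((a + 1 : ℕ) : ℤ) = n + a := by push_cast; ring
  rw [hn]
  split_ifs with h
  · obtain ⟨k, hk⟩ := Int.eq_ofNat_of_zero_le h
    have : 1 - n = (a : ℤ) + 1 - k := by omega
    rw [hk, Int.toNat_natCast, this, zsmul_eq_mul]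
    push_cast
    rfl
  · simp

lemma Rpq_succ (a b : ℕ) :
    Rpq (a + 1) b = ((a : Rf) + 1) * normTwoPoint (laxSeries MvPolynomial.X) a b := by
  have hC : ((a : Rf⟦X⟧) + 1) = C ((a : Rf) + 1) := by simp
  rw [Rpq, plus_lam_pow, derivP_lam_pow_succ, shiftedSeries_mul, pres, coeff_shiftedSeries,
    if_pos (by omega), mul_left_comm, hC, coeff_C_mul, normTwoPoint,
    show (1 + ((b : ℤ) + a)).toNat = a + 1 + b by omega]
  ring

section Specialization

variable {A : Type*} [CommRing A] [Algebra ℚ A]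

lemma aeval_wv (x : ℕ → A) (i : ℕ) :
    MvPolynomial.aeval x (wv i) = coeff (i + 1) (laxSeries x ^ i) := by
  have h := map_laxSeries (MvPolynomial.aeval x : Rf →ₐ[ℚ] A).toRingHom MvPolynomial.X
  simp only [AlgHom.toRingHom_eq_coe, RingHom.coe_coe, MvPolynomial.aeval_X] at h
  rw [wv_eq, ← h, ← map_pow, PowerSeries.coeff_map]
  rfl

lemma aeval_Rpq_succ (x : ℕ → A) (a b : ℕ) :
    MvPolynomial.aeval x (Rpq (a + 1) b) = ((a : A) + 1) * normTwoPoint (laxSeries x) a b := by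
  have h := map_laxSeries (MvPolynomial.aeval x : Rf →ₐ[ℚ] A).toRingHom MvPolynomial.X
  simp only [AlgHom.toRingHom_eq_coe, RingHom.coe_coe, MvPolynomial.aeval_X] at h
  rw [Rpq_succ, ← h, ← map_normTwoPoint]
  simp

/-- The `wᵢ` can be specialized to arbitrary values. -/
lemma exists_aeval_wv_eq (W : ℕ → A) (hW : W 0 = 0) (N : ℕ) :
    ∃ x : ℕ → A, ∀ i ≤ N, MvPolynomial.aeval x (wv i) = W i := by
  induction N with
  | zero =>
    refine ⟨0, fun i hi => ?_⟩
    obtain rfl : i = 0 := by omega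
    rw [hW, aeval_wv]
    simp [coeff_one]
  | succ N ih =>
    obtain ⟨x, hx⟩ := ih
    refine ⟨Function.update x (N + 1) (x (N + 1) + ((N : ℚ) + 1)⁻¹ •
      (W (N + 1) - MvPolynomial.aeval x (wv (N + 1)))), fun i hi => ?_⟩
    have key := coeff_laxSeries_pow_sub (Function.update x (N + 1) (x (N + 1) + ((N : ℚ) + 1)⁻¹ •
      (W (N + 1) - MvPolynomial.aeval x (wv (N + 1))))) x i
      (fun j hj => Function.update_of_ne (by omega) _ _)
    rw [← aeval_wv, ← aeval_wv] at key
    rcases Nat.lt_or_ge N i with h | h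
    · obtain rfl : i = N + 1 := by omega
      have hn : ((N : ℚ) + 1) ≠ 0 := by positivity
      have hc : (((N + 1 : ℕ) : A)) = algebraMap ℚ A ((N : ℚ) + 1) := by simp
      rw [Function.update_self, add_sub_cancel_left, hc, ← Algebra.smul_def, smul_smul,
        mul_inv_cancel₀ hn, one_smul] at key
      exact sub_left_injective key
    · rw [Function.update_of_ne (by omega), sub_self, mul_zero, sub_eq_zero] at key
      rw [key, hx i h]

end Specialization

end LaxSeries

section SquareFreeCoefficients

open MvPolynomial

/-- The exponent of the monomial `∏ j ∈ I, X j`. -/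
noncomputable def indExp {σ : Type*} (I : Finset σ) : σ →₀ ℕ := ∑ j ∈ I, Finsupp.single j 1

lemma indExp_apply {σ : Type*} [DecidableEq σ] (I : Finset σ) (j : σ) :
    indExp I j = if j ∈ I then 1 else 0 := by
  simp [indExp, Finsupp.finsetSum_apply, Finsupp.single_apply]

lemma coeff_indExp_X_mul {σ R : Type*} [DecidableEq σ] [CommSemiring R] (I : Finset σ) (j : σ)
    (p : MvPolynomial σ R) :
    coeff (indExp I) (X j * p) = if j ∈ I then coeff (indExp (I.erase j)) p else 0 := by
  simp only [coeff_X_mul', Finsupp.mem_support_iff, indExp_apply]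
  by_cases h : j ∈ I
  · have : indExp I = Finsupp.single j 1 + indExp (I.erase j) := (add_sum_erase I _ h).symm
    rw [if_pos h, if_pos h, if_pos one_ne_zero, this, add_tsub_cancel_left]
  · simp [h]

lemma eval_zero_foldl_pderiv {σ R : Type*} [DecidableEq σ] [CommSemiring R] (js : List σ)
    (hjs : js.Nodup) (p : MvPolynomial σ R) :
    eval (fun _ => (0 : R)) (js.foldl (fun T i => pderiv i T) p) =
      coeff (indExp js.toFinset) p := by
  induction js generalizing p with
  | nil =>
    rw [eval_zero', constantCoeff_eq]
    simp [indExp]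
  | cons j js ih =>
    rw [List.nodup_cons] at hjs
    have hj : j ∉ js.toFinset := by simpa using hjs.1
    rw [List.foldl_cons, ih hjs.2, coeff_pderiv, indExp_apply, if_neg hj, List.toFinset_cons,
      indExp, indExp, sum_insert hj, add_comm]
    simp

variable {n : ℕ}

/-- The specialization `w_m = ∑_{j : l j = m} t_j`. -/
noncomputable def linearForm (l : Fin n → ℕ) (m : ℕ) : MvPolynomial (Fin n) ℚ :=
  ∑ j, if l j = m then X j else 0

lemma pderiv_aeval_linearForm (l : Fin n → ℕ) (j : Fin n) (S : MvPolynomial ℕ ℚ) :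
    pderiv j (aeval (linearForm l) S) = aeval (linearForm l) (pderiv (l j) S) := by
  induction S using MvPolynomial.induction_on with
  | C a => simp
  | add p q hp hq => simp only [map_add, hp, hq]
  | mul_X p m hp =>
    have hm : pderiv j (linearForm l m) = if l j = m then 1 else 0 := by
      rw [linearForm, map_sum, sum_eq_single j]
      · split_ifs <;> simp
      · intro i _ hij
        split_ifs
        · exact pderiv_X_of_ne hij
        · simp
      · simp
    simp only [map_mul, Derivation.leibniz, hp, aeval_X, map_add, smul_eq_mul, hm, pderiv_X]
    rcases eq_or_ne (l j) m with h | h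
    · simp [h]
    · simp [h, h.symm]

lemma eval_zero_foldl_pderiv_ofFn (l : Fin n → ℕ) (S : MvPolynomial ℕ ℚ) :
    eval (fun _ => (0 : ℚ)) ((List.ofFn l).foldl (fun T i => pderiv i T) S) =
      coeff (indExp univ) (aeval (linearForm l) S) := by
  have key : ∀ (js : List (Fin n)) (S : MvPolynomial ℕ ℚ),
      aeval (linearForm l) ((js.map l).foldl (fun T i => pderiv i T) S) =
        js.foldl (fun T i => pderiv i T) (aeval (linearForm l) S) := by
    intro js
    induction js with
    | nil => simp
    | cons j js ih =>
      intro S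
      rw [List.map_cons, List.foldl_cons, List.foldl_cons, ih, pderiv_aeval_linearForm]
  have heval : ∀ (T : MvPolynomial ℕ ℚ), eval (fun _ => (0 : ℚ)) (aeval (linearForm l) T) =
      eval (fun _ => (0 : ℚ)) T := by
    intro T
    induction T using MvPolynomial.induction_on with
    | C a => simp
    | add p q hp hq => simp only [map_add, hp, hq]
    | mul_X p m hp =>
      rw [map_mul, map_mul, map_mul, hp, aeval_X, eval_X, linearForm, map_sum, sum_eq_zero]
      intro j _
      split_ifs <;> simp
  rw [List.ofFn_eq_map, ← heval, key, eval_zero_foldl_pderiv _ (List.nodup_finRange n)]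
  congr 2
  ext j
  simp

lemma coeff_indExp_linearForm_mul (l : Fin n → ℕ) (m : ℕ) (I : Finset (Fin n))
    (p : MvPolynomial (Fin n) ℚ) :
    coeff (indExp I) (linearForm l m * p) =
      ∑ j ∈ I, if l j = m then coeff (indExp (I.erase j)) p else 0 := by
  rw [linearForm, sum_mul, coeff_sum, ← sum_filter_add_sum_filter_not univ (· ∈ I),
    sum_eq_zero (s := univ.filter (· ∉ I)), add_zero, filter_mem_eq_inter, univ_inter]
  · refine sum_congr rfl fun j hj => ?_
    split_ifs
    · rw [coeff_indExp_X_mul, if_pos hj]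
    · simp
  · intro j hj
    rw [mem_filter] at hj
    split_ifs
    · rw [coeff_indExp_X_mul, if_neg hj.2]
    · simp

end SquareFreeCoefficients

section TwoVariables

open MvPolynomial

/-- The exponent of `z ^ a * ζ ^ b`. -/
noncomputable def biExp (a b : ℕ) : Fin 2 →₀ ℕ := Finsupp.single 0 a + Finsupp.single 1 b

lemma biExp_zero (a b : ℕ) : biExp a b 0 = a := by simp [biExp]

lemma biExp_one (a b : ℕ) : biExp a b 1 = b := by simp [biExp]

lemma X_pow_mul_X_pow_eq_monomial (i j : ℕ) :
    (X 0 ^ i * X 1 ^ j : MvPolynomial (Fin 2) ℚ) = monomial (biExp i j) 1 := by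
  rw [X_pow_eq_monomial, X_pow_eq_monomial, monomial_mul, one_mul, biExp]

lemma coeff_X_pow_mul_X_pow_mul (i j a b : ℕ) (p : MvPolynomial (Fin 2) ℚ) :
    coeff (biExp a b) (X 0 ^ i * X 1 ^ j * p) =
      if i ≤ a ∧ j ≤ b then coeff (biExp (a - i) (b - j)) p else 0 := by
  have h1 : biExp i j ≤ biExp a b ↔ i ≤ a ∧ j ≤ b := by
    rw [Finsupp.le_def, Fin.forall_fin_two]
    simp only [biExp_zero, biExp_one]
  have h2 : biExp a b - biExp i j = biExp (a - i) (b - j) := by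
    ext k
    rw [Finsupp.tsub_apply]
    fin_cases k
    · exact (by simp only [biExp_zero] : biExp a b 0 - biExp i j 0 = biExp (a - i) (b - j) 0)
    · exact (by simp only [biExp_one] : biExp a b 1 - biExp i j 1 = biExp (a - i) (b - j) 1)
  rw [X_pow_mul_X_pow_eq_monomial, coeff_monomial_mul', one_mul, h2]
  simp only [h1]

lemma coeff_biExp_X_pow_mul_X_pow (i j a b : ℕ) :
    coeff (biExp a b) (X 0 ^ i * X 1 ^ j : MvPolynomial (Fin 2) ℚ) =
      if a = i ∧ b = j then 1 else 0 := by
  rw [X_pow_mul_X_pow_eq_monomial, coeff_monomial]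
  refine if_congr ⟨fun h => ?_, fun h => by rw [h.1, h.2]⟩ rfl rfl
  have h0 := congrArg (fun e => e 0) h
  have h1 := congrArg (fun e => e 1) h
  simp only [biExp_zero, biExp_one] at h0 h1
  exact ⟨h0.symm, h1.symm⟩

/-- The Euler derivation `ζ ∂/∂ζ`. -/
noncomputable def eulerZeta : Derivation ℚ (MvPolynomial (Fin 2) ℚ) (MvPolynomial (Fin 2) ℚ) :=
  (X 1 : MvPolynomial (Fin 2) ℚ) • pderiv 1

lemma coeff_eulerZeta (a b : ℕ) (p : MvPolynomial (Fin 2) ℚ) :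
    coeff (biExp a b) (eulerZeta p) = b * coeff (biExp a b) p := by
  have h := coeff_X_pow_mul_X_pow_mul 0 1 a b (pderiv 1 p)
  rw [pow_zero, pow_one, one_mul] at h
  rw [eulerZeta, Derivation.smul_apply, smul_eq_mul, h]
  cases b with
  | zero => simp
  | succ b =>
    have : biExp a b + Finsupp.single 1 1 = biExp a (b + 1) := by
      rw [biExp, biExp, add_assoc, ← Finsupp.single_add]
    rw [if_pos (by omega), coeff_pderiv, Nat.add_sub_cancel, Nat.sub_zero, biExp_one, this]
    push_cast
    ring

lemma coeff_sPolQ (l a b : ℕ) :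
    coeff (biExp a b) (sPolQ l) = if 1 ≤ a ∧ 1 ≤ b ∧ a + b = l + 1 then -1 else 0 := by
  rw [sPolQ, coeff_neg, coeff_sum]
  simp only [coeff_biExp_X_pow_mul_X_pow]
  split_ifs with h
  · rw [sum_eq_single (a - 1)]
    · rw [if_pos (by omega)]
    · intro k _ hk
      rw [if_neg (by omega)]
    · intro hk
      rw [mem_range] at hk
      omega
  · rw [sum_eq_zero, neg_zero]
    intro k hk
    rw [mem_range] at hk
    rw [if_neg (by omega)]

lemma sub_mul_sPolQ (l : ℕ) :
    (X 0 - X 1) * sPolQ l = X 0 * X 1 * (X 1 ^ l - X 0 ^ l : MvPolynomial (Fin 2) ℚ) := by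
  have h : sPolQ l = -(X 0 * X 1 * ∑ k ∈ range l, X 0 ^ k * X 1 ^ (l - 1 - k)) := by
    rw [sPolQ, mul_sum]
    congr 1
    refine sum_congr rfl fun k hk => ?_
    rw [mem_range] at hk
    rw [show l - k = l - 1 - k + 1 by omega]
    ring
  have hg := geom_sum₂_mul (X 0 : MvPolynomial (Fin 2) ℚ) (X 1) l
  rw [h]
  linear_combination (-(X 0 * X 1) : MvPolynomial (Fin 2) ℚ) * hg

lemma leibniz_finset_prod {ι R A : Type*} [DecidableEq ι] [CommSemiring R] [CommRing A]
    [Algebra R A] (D : Derivation R A A) (s : ι → A) (I : Finset ι) :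
    D (∏ i ∈ I, s i) = ∑ j ∈ I, (∏ i ∈ I.erase j, s i) * D (s j) := by
  induction I using Finset.induction_on with
  | empty => simp
  | insert k I hk ih =>
    rw [prod_insert hk, sum_insert hk, erase_insert hk, D.leibniz, ih, smul_eq_mul, smul_eq_mul,
      mul_sum, add_comm]
    congr 1
    refine sum_congr rfl fun j hj => ?_
    rw [erase_insert_of_ne (ne_of_mem_of_not_mem hj hk).symm,
      prod_insert (fun h => hk (mem_of_mem_erase h))]
    ring

/-- Summing the Leibniz rule over all ways to split off one factor. -/
lemma sum_mul_derivation_prod_erase {ι R A : Type*} [DecidableEq ι] [CommSemiring R] [CommRing A]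
    [Algebra R A] (D : Derivation R A A) (s : ι → A) (I : Finset ι) :
    ∑ j ∈ I, s j * D (∏ i ∈ I.erase j, s i) = ((I.card : A) - 1) * D (∏ i ∈ I, s i) := by
  have h : ∀ j ∈ I, s j * D (∏ i ∈ I.erase j, s i) =
      D (∏ i ∈ I, s i) - (∏ i ∈ I.erase j, s i) * D (s j) := by
    intro j hj
    rw [← mul_prod_erase I s hj, D.leibniz, smul_eq_mul, smul_eq_mul]
    ring
  rw [sum_congr rfl h, sum_sub_distrib, ← leibniz_finset_prod, sum_const, nsmul_eq_mul]
  ring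

variable {ι : Type*}

/-- The coefficients of `ζ ∂/∂ζ ∏_{j ∈ I} sPolQ (l j)`. -/
noncomputable def prodCoeff (l : ι → ℕ) (I : Finset ι) (a b : ℕ) : ℚ :=
  b * coeff (biExp a b) (∏ j ∈ I, sPolQ (l j))

lemma prodCoeff_empty (l : ι → ℕ) (a b : ℕ) : prodCoeff l ∅ a b = 0 := by
  have h := coeff_biExp_X_pow_mul_X_pow 0 0 a b
  rw [pow_zero, pow_zero, one_mul] at h
  rw [prodCoeff, prod_empty, h]
  split_ifs with h <;> simp [h]

lemma prodCoeff_zero_left (l : ι → ℕ) (I : Finset ι) (b : ℕ) : prodCoeff l I 0 b = 0 := by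
  classical
  rcases I.eq_empty_or_nonempty with rfl | ⟨j, hj⟩
  · exact prodCoeff_empty l 0 b
  have h : sPolQ (l j) = X 0 ^ 1 * X 1 ^ 0 *
      -∑ k ∈ range (l j), X 0 ^ k * X 1 ^ (l j - k) := by
    rw [sPolQ, mul_neg, mul_sum]
    congr 1
    exact sum_congr rfl fun k _ => by ring
  rw [prodCoeff, ← mul_prod_erase I _ hj, h, mul_assoc, coeff_X_pow_mul_X_pow_mul, if_neg (by omega),
    mul_zero]

lemma prodCoeff_recursion [DecidableEq ι] (l : ι → ℕ) (I : Finset ι) (a b : ℕ) :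
    ((I.card : ℚ) - 1) * (prodCoeff l I (a + 1) (b + 1) - prodCoeff l I (a + 2) b) =
      ∑ j ∈ I, ((if l j ≤ b then prodCoeff l (I.erase j) (a + 1) (b - l j) else 0) -
        if l j ≤ a then prodCoeff l (I.erase j) (a + 1 - l j) b else 0) := by
  set F : Finset ι → MvPolynomial (Fin 2) ℚ := fun I => eulerZeta (∏ j ∈ I, sPolQ (l j)) with hF
  have hc : ∀ I a b, coeff (biExp a b) (F I) = prodCoeff l I a b := fun I a b =>
    coeff_eulerZeta a b _
  have hpoly : C ((I.card : ℚ) - 1) * (X 0 ^ 1 * X 1 ^ 0 * F I - X 0 ^ 0 * X 1 ^ 1 * F I) =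
      ∑ j ∈ I, (X 0 ^ 1 * X 1 ^ (l j + 1) * F (I.erase j)
        - X 0 ^ (l j + 1) * X 1 ^ 1 * F (I.erase j)) := by
    have hs := sum_mul_derivation_prod_erase eulerZeta (fun j => sPolQ (l j)) I
    have : ∀ j ∈ I, X 0 ^ 1 * X 1 ^ (l j + 1) * F (I.erase j)
        - X 0 ^ (l j + 1) * X 1 ^ 1 * F (I.erase j) =
        (X 0 - X 1) * (sPolQ (l j) * F (I.erase j)) := by
      intro j _
      rw [← mul_assoc, sub_mul_sPolQ]
      ring
    rw [sum_congr rfl this, ← mul_sum, hs, map_sub, map_natCast, map_one]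
    ring
  have h := congrArg (coeff (biExp (a + 2) (b + 1))) hpoly
  rw [coeff_C_mul, coeff_sub, coeff_X_pow_mul_X_pow_mul, coeff_X_pow_mul_X_pow_mul,
    if_pos (by omega), if_pos (by omega), coeff_sum, hc, hc] at h
  refine h.trans (sum_congr rfl fun j _ => ?_)
  rw [coeff_sub, coeff_X_pow_mul_X_pow_mul, coeff_X_pow_mul_X_pow_mul, hc, hc]
  congr 1
  · rw [show b + 1 - (l j + 1) = b - l j by omega]
    exact if_congr (by omega) rfl rfl
  · rw [show a + 2 - (l j + 1) = a + 1 - l j by omega]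
    rcases eq_or_ne (l j) (a + 1) with h | h
    · rw [if_pos (by omega), if_neg (by omega), h, Nat.sub_self, prodCoeff_zero_left]
    · exact if_congr (by omega) rfl rfl

end TwoVariables

section Assembly

open MvPolynomial

variable {n : ℕ}

/-- The factor in front of `prodCoeff l I` in the coefficient of `∏ j ∈ I, t_j`. -/
noncomputable def twoPointFactor (l : Fin n → ℕ) (I : Finset (Fin n)) : ℚ :=
  -((I.card - 1).factorial / ∏ j ∈ I, (l j : ℚ))

lemma twoPointFactor_erase (l : Fin n → ℕ) (hl : ∀ i, 1 ≤ l i) {I : Finset (Fin n)}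
    (hI : 2 ≤ I.card) {j : Fin n} (hj : j ∈ I) :
    (l j : ℚ)⁻¹ * twoPointFactor l (I.erase j) * ((I.card : ℚ) - 1) = twoPointFactor l I := by
  have hlj : ∀ i, (l i : ℚ) ≠ 0 := fun i => by have := hl i; positivity
  have hp : ∏ i ∈ I.erase j, (l i : ℚ) ≠ 0 := prod_ne_zero_iff.mpr fun i _ => hlj i
  rw [twoPointFactor, twoPointFactor, card_erase_of_mem hj, ← mul_prod_erase I _ hj]
  obtain ⟨k, hk⟩ := Nat.exists_eq_add_of_le hI
  rw [hk, show 2 + k - 1 - 1 = k by omega, show 2 + k - 1 = k + 1 by omega, Nat.factorial_succ]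
  have := hlj j
  push_cast
  field_simp
  ring

/-- The recursion of `normTwoPoint` holds for the claimed coefficients. -/
lemma twoPointFactor_mul_prodCoeff_succ (l : Fin n → ℕ) (hl : ∀ i, 1 ≤ l i) (I : Finset (Fin n))
    (a b : ℕ) :
    twoPointFactor l I * prodCoeff l I (a + 1) (b + 1) =
      twoPointFactor l I * prodCoeff l I (a + 2) b
      + (∑ j ∈ I, if l j = a + 1 + b then (l j : ℚ)⁻¹ * (if I.erase j = ∅ then 1 else 0) else 0)
      - (∑ j ∈ I, if l j ≤ a then
          (l j : ℚ)⁻¹ * (twoPointFactor l (I.erase j) * prodCoeff l (I.erase j) (a + 1 - l j) b)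
          else 0)
      + ∑ j ∈ I, if l j ≤ b then
          (l j : ℚ)⁻¹ * (twoPointFactor l (I.erase j) * prodCoeff l (I.erase j) (a + 1) (b - l j))
          else 0 := by
  rcases Nat.lt_or_ge I.card 2 with hI | hI
  · rcases Nat.lt_or_ge I.card 1 with h0 | h1
    · obtain rfl : I = ∅ := card_eq_zero.mp (by omega)
      simp [prodCoeff_empty]
    · obtain ⟨j, rfl⟩ := card_eq_one.mp (show I.card = 1 by omega)
      have hlj := hl j
      simp only [sum_singleton, erase_singleton, prodCoeff_empty, mul_zero, ite_self, if_true,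
        mul_one, sub_zero, add_zero]
      simp only [twoPointFactor, card_singleton, prod_singleton, prodCoeff, coeff_sPolQ]
      by_cases h : l j = a + 1 + b
      · rw [if_pos (by omega), if_pos h]
        rcases Nat.eq_zero_or_pos b with rfl | hb
        · simp
        · rw [if_pos (by omega)]
          push_cast
          simp
          ring
      · rw [if_neg (by omega), if_neg h, if_neg (by omega)]
        simp
  · have hv : (∑ j ∈ I, if l j = a + 1 + b then
        (l j : ℚ)⁻¹ * (if I.erase j = ∅ then 1 else 0) else 0) = 0 := by
      refine sum_eq_zero fun j hj => ?_
      have : I.erase j ≠ ∅ := by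
        rw [Ne, ← card_eq_zero, card_erase_of_mem hj]
        omega
      simp [this]
    have hn : ((I.card : ℚ) - 1) ≠ 0 := by
      have : (2 : ℚ) ≤ I.card := by exact_mod_cast hI
      linarith
    have key := congrArg (twoPointFactor l I * ·) (prodCoeff_recursion l I a b)
    simp only [mul_sum] at key
    have hj : ∀ j ∈ I, twoPointFactor l I *
        ((if l j ≤ b then prodCoeff l (I.erase j) (a + 1) (b - l j) else 0) -
          if l j ≤ a then prodCoeff l (I.erase j) (a + 1 - l j) b else 0) =
        ((I.card : ℚ) - 1) * ((if l j ≤ b then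
          (l j : ℚ)⁻¹ * (twoPointFactor l (I.erase j) * prodCoeff l (I.erase j) (a + 1) (b - l j))
          else 0) - if l j ≤ a then
          (l j : ℚ)⁻¹ * (twoPointFactor l (I.erase j) * prodCoeff l (I.erase j) (a + 1 - l j) b)
          else 0) := by
      intro j hj
      rw [← twoPointFactor_erase l hl hI hj]
      split_ifs <;> ring
    rw [sum_congr rfl hj, ← mul_sum, sum_sub_distrib] at key
    rw [hv]
    apply mul_left_cancel₀ hn
    linear_combination key

lemma normRes_laxSeries (l : Fin n → ℕ) (x : ℕ → MvPolynomial (Fin n) ℚ) {i : ℕ}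
    (hx : aeval x (wv i) = linearForm l i) :
    normRes (laxSeries x) i = C (i : ℚ)⁻¹ * linearForm l i := by
  rw [normRes, ← aeval_wv, hx, smul_eq_C_mul]

lemma coeff_indExp_normRes_mul (l : Fin n → ℕ) (x : ℕ → MvPolynomial (Fin n) ℚ) {i : ℕ}
    (hx : aeval x (wv i) = linearForm l i) (I : Finset (Fin n)) (p : MvPolynomial (Fin n) ℚ) :
    coeff (indExp I) (normRes (laxSeries x) i * p) =
      ∑ j ∈ I, if l j = i then (l j : ℚ)⁻¹ * coeff (indExp (I.erase j)) p else 0 := by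
  rw [normRes_laxSeries l x hx, mul_assoc, coeff_C_mul, coeff_indExp_linearForm_mul, mul_sum]
  refine sum_congr rfl fun j _ => ?_
  split_ifs with h
  · rw [h]
  · rw [mul_zero]

lemma coeff_indExp_one {σ : Type*} [DecidableEq σ] (I : Finset σ) :
    coeff (indExp I) (1 : MvPolynomial σ ℚ) = if I = ∅ then 1 else 0 := by
  rw [coeff_one]
  refine if_congr ⟨fun h => ?_, fun h => by rw [h, indExp, sum_empty]⟩ rfl rfl
  rw [eq_empty_iff_forall_notMem]
  intro j hj
  have := congrArg (fun e => e j) h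
  simp [indExp_apply, hj] at this

lemma sum_range_ite_succ_eq {m k : ℕ} (hk : 1 ≤ k) (g : ℕ → ℚ) :
    (∑ i ∈ range m, if k = i + 1 then g i else 0) = if k ≤ m then g (k - 1) else 0 := by
  split_ifs with h
  · rw [sum_eq_single (k - 1)]
    · rw [if_pos (by omega)]
    · intro i _ hi
      rw [if_neg (by omega)]
    · intro hi
      rw [mem_range] at hi
      omega
  · refine sum_eq_zero fun i hi => ?_
    rw [mem_range] at hi
    rw [if_neg (by omega)]

lemma coeff_indExp_normTwoPoint (l : Fin n → ℕ) (hl : ∀ i, 1 ≤ l i)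
    (x : ℕ → MvPolynomial (Fin n) ℚ) (N : ℕ)
    (hx : ∀ i ≤ N, aeval x (wv i) = linearForm l i) (b : ℕ) :
    ∀ a, a + b ≤ N → ∀ I : Finset (Fin n),
      coeff (indExp I) (normTwoPoint (laxSeries x) a b) =
        twoPointFactor l I * prodCoeff l I (a + 1) b := by
  induction b using Nat.strong_induction_on with
  | _ b ih =>
  intro a hab I
  cases b with
  | zero => simp [normTwoPoint_zero, prodCoeff]
  | succ b =>
    obtain ⟨M, hM⟩ := exists_mul_laxSeries_eq_one x
    rw [normTwoPoint_succ hM (constantCoeff_laxSeries x) (coeff_one_laxSeries x), coeff_add,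
      coeff_sub, coeff_add, coeff_sum, coeff_sum, ih b (by omega) (a + 1) (by omega),
      twoPointFactor_mul_prodCoeff_succ l hl]
    congr 1
    · congr 1
      · congr 1
        rw [← mul_one (normRes _ _), coeff_indExp_normRes_mul l x (hx _ (by omega))]
        simp only [coeff_indExp_one]
      · have : ∀ i ∈ range a, coeff (indExp I) (normRes (laxSeries x) (i + 1) *
            normTwoPoint (laxSeries x) (a - 1 - i) b) = ∑ j ∈ I, if l j = i + 1 then
            (l j : ℚ)⁻¹ * (twoPointFactor l (I.erase j) *
              prodCoeff l (I.erase j) (a - 1 - i + 1) b) else 0 := by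
          intro i hi
          rw [mem_range] at hi
          rw [coeff_indExp_normRes_mul l x (hx _ (by omega))]
          simp only [ih b (by omega) (a - 1 - i) (by omega)]
        rw [sum_congr rfl this, sum_comm]
        refine sum_congr rfl fun j _ => ?_
        have hlj := hl j
        rw [sum_range_ite_succ_eq hlj]
        split_ifs
        · rw [show a - 1 - (l j - 1) + 1 = a + 1 - l j by omega]
        · rfl
    · have : ∀ i ∈ range b, coeff (indExp I) (normRes (laxSeries x) (i + 1) *
          normTwoPoint (laxSeries x) a (b - 1 - i)) = ∑ j ∈ I, if l j = i + 1 then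
          (l j : ℚ)⁻¹ * (twoPointFactor l (I.erase j) *
            prodCoeff l (I.erase j) (a + 1) (b - 1 - i)) else 0 := by
        intro i hi
        rw [mem_range] at hi
        rw [coeff_indExp_normRes_mul l x (hx _ (by omega))]
        simp only [ih (b - 1 - i) (by omega) a (by omega)]
      rw [sum_congr rfl this, sum_comm]
      refine sum_congr rfl fun j _ => ?_
      have hlj := hl j
      rw [sum_range_ite_succ_eq hlj]
      split_ifs
      · rw [show b - 1 - (l j - 1) = b - l j by omega]
      · rfl

end Assembly

/-- for `n, p, q, l₁, …, lₙ ≥ 1` with `p + q = n + ∑ lᵢ`, writing `R_{p,q}` as a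
polynomial `S` in the variables `w₁, w₂, …` (i.e. any `S` with `S(w₁, w₂, …) = R_{p,q}`),
`(1/(pq)) ∂ⁿS/∂w_{l₁}⋯∂w_{lₙ} |_{w=0}
   = -((n-1)!/∏ lᵢ) Coef_{z^p ζ^q} ∏ᵢ (z^{lᵢ} - ζ^{lᵢ})/(z⁻¹ - ζ⁻¹)`. -/
theorem statement13 (n p q : ℕ) (l : Fin n → ℕ) (hn : 1 ≤ n) (hp : 1 ≤ p) (hq : 1 ≤ q)
    (hl : ∀ i, 1 ≤ l i) (hsum : p + q = n + ∑ i, l i)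
    (S : MvPolynomial ℕ ℚ) (hS : MvPolynomial.aeval (fun i => wv i) S = Rpq p q) :
    ((p : ℚ) * (q : ℚ))⁻¹ *
        MvPolynomial.eval (fun _ => (0 : ℚ))
          ((List.ofFn l).foldl (fun T i => MvPolynomial.pderiv i T) S) =
      -(((n - 1).factorial : ℚ) / ∏ i, (l i : ℚ)) *
        MvPolynomial.coeff (Finsupp.single 0 p + Finsupp.single 1 q)
          (∏ i, sPolQ (l i)) := by
  obtain ⟨a, rfl⟩ : ∃ a, p = a + 1 := ⟨p - 1, by omega⟩
  have hW : linearForm l 0 = 0 := by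
    rw [linearForm]
    refine sum_eq_zero fun j _ => if_neg ?_
    have := hl j
    omega
  obtain ⟨x, hx⟩ := exists_aeval_wv_eq (linearForm l) hW (a + q + S.vars.sup id)
  have hS' : MvPolynomial.aeval (linearForm l) S =
      ((a : MvPolynomial (Fin n) ℚ) + 1) * normTwoPoint (laxSeries x) a q := by
    have hcomp : MvPolynomial.aeval x (MvPolynomial.aeval (fun i => wv i) S) =
        MvPolynomial.aeval (fun i => MvPolynomial.aeval x (wv i)) S := by
      rw [← AlgHom.comp_apply, MvPolynomial.comp_aeval]
    rw [← aeval_Rpq_succ, ← hS, hcomp]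
    refine MvPolynomial.eval₂Hom_congr' rfl (fun i hi _ => (hx i ?_).symm) rfl
    have : i ≤ S.vars.sup id := le_sup (f := id) hi
    omega
  have hC : ((a : MvPolynomial (Fin n) ℚ) + 1) = MvPolynomial.C ((a : ℚ) + 1) := by simp
  rw [eval_zero_foldl_pderiv_ofFn, hS', hC, MvPolynomial.coeff_C_mul,
    coeff_indExp_normTwoPoint l hl x _ hx q a (by omega), prodCoeff, twoPointFactor, card_univ,
    Fintype.card_fin, biExp]
  have ha : ((a : ℚ) + 1) ≠ 0 := by positivity
  have hq' : (q : ℚ) ≠ 0 := by positivity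
  push_cast
  field_simp
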